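/- arXiv:1610.07395 — 2 statements merged into one kernel-verified Lean document; each statement's English description precedes it below -/
import Mathlib

section
/- Let $c>1$ be real with $c\notin\mathbb{N}$ and set $\gamma=1/c$. For every $\varepsilon>0$ there is a constant $C$ (depending only on $c$ and $\varepsilon$) such that for all positive integers $s$ and all $N\ge 2$, $\bigl|Q_c(s;N) - \gamma(2\gamma-1)^{-1} s^{-1/2} N^{1-c/2}\bigr| \le C\bigl(s^{-1/6} N^{(2+c)/6+\varepsilon} + N^{1/2+\varepsilon}\bigr)$. In particular, $Q_c(s;N) \le C' \bigl(s^{-1/6} N^{(2+c)/6+\varepsilon} + N^{1/2+\varepsilon}\bigr)$ for some constant $C'$ depending only on $c$ and $\varepsilon$. -/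
/-- `Qc c s N` is the number of pairs of positive integers `(n, m)` with `n ≤ N` and
`⌊n^c⌋ = s * m^2`. -/
noncomputable def Qc (c : ℝ) (s N : ℕ) : ℕ :=
  Set.ncard {p : ℕ × ℕ | 0 < p.1 ∧ p.1 ≤ N ∧ 0 < p.2 ∧
    ⌊(p.1 : ℝ) ^ c⌋ = (s : ℤ) * (p.2 : ℤ) ^ 2}

/-- A lower bound for the second derivative bounds the second difference from below. -/
lemma second_difference_lower_bound {f f' f'' : ℝ → ℝ} {a b l : ℝ}
    (hf : ∀ x ∈ Set.Icc a b, HasDerivAt f (f' x) x)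
    (hf' : ∀ x ∈ Set.Icc a b, HasDerivAt f' (f'' x) x)
    (hl : ∀ x ∈ Set.Icc a b, l ≤ f'' x) {p q r : ℝ}
    (hap : a ≤ p) (hpq : p < q) (hqr : q < r) (hrb : r ≤ b) :
    l / 2 * ((q - p) * (r - q) * (r - p)) ≤ (q - p) * f r - (r - p) * f q + (r - q) * f p := by
  have hconv : ConvexOn ℝ (Set.Icc a b) (fun x => f x - l / 2 * x ^ 2) := by
    refine convexOn_of_hasDerivWithinAt2_nonneg (convex_Icc a b)
      (f' := fun x => f' x - l * x) (f'' := fun x => f'' x - l) ?_ ?_ ?_ ?_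
    · exact ContinuousOn.sub (fun x hx => (hf x hx).continuousAt.continuousWithinAt)
        (by fun_prop)
    · intro x hx
      have h2 : HasDerivAt (fun x : ℝ => l / 2 * x ^ 2) (l * x) x :=
        ((hasDerivAt_pow 2 x).const_mul (l / 2)).congr_deriv (by norm_num; ring)
      exact ((hf x (interior_subset hx)).sub h2).hasDerivWithinAt
    · intro x hx
      have h2 : HasDerivAt (fun x : ℝ => l * x) l x :=
        ((hasDerivAt_id x).const_mul l).congr_deriv (by simp)
      exact ((hf' x (interior_subset hx)).sub h2).hasDerivWithinAt
    · intro x hx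
      exact sub_nonneg.2 (hl x (interior_subset hx))
  have hpr : 0 < r - p := by linarith
  have h := hconv.2 (show p ∈ Set.Icc a b from ⟨hap, by linarith⟩)
    (show r ∈ Set.Icc a b from ⟨by linarith, hrb⟩)
    (show 0 ≤ (r - q) / (r - p) from div_nonneg (by linarith) hpr.le)
    (show 0 ≤ (q - p) / (r - p) from div_nonneg (by linarith) hpr.le)
    (by field_simp; ring)
  have hq : (r - q) / (r - p) * p + (q - p) / (r - p) * r = q := by field_simp; ring
  simp only [smul_eq_mul, hq] at h
  have h' := mul_le_mul_of_nonneg_left h hpr.le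
  have e : (r - p) * ((r - q) / (r - p) * (f p - l / 2 * p ^ 2) +
      (q - p) / (r - p) * (f r - l / 2 * r ^ 2)) =
      (r - q) * (f p - l / 2 * p ^ 2) + (q - p) * (f r - l / 2 * r ^ 2) := by
    field_simp
  rw [e] at h'
  linarith [h']

/-- The second difference of `x ↦ A * x ^ α` on a dyadic interval. -/
lemma abs_second_difference_rpow {α A X : ℝ} (hα0 : 0 < α) (hα2 : α < 2) (hA : 0 < A)
    (hX : 0 < X) {p q r : ℝ}
    (hp : X ≤ p) (hpq : p < q) (hqr : q < r) (hr : r ≤ 2 * X) :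
    |α * (α - 1)| / 8 * (A * X ^ (α - 2)) * ((q - p) * (r - q) * (r - p)) ≤
        |(q - p) * (A * r ^ α) - (r - p) * (A * q ^ α) + (r - q) * (A * p ^ α)| ∧
      |(q - p) * (A * r ^ α) - (r - p) * (A * q ^ α) + (r - q) * (A * p ^ α)| ≤
        |α * (α - 1)| / 2 * (A * X ^ (α - 2)) * ((q - p) * (r - q) * (r - p)) := by
  have hpos : ∀ x ∈ Set.Icc X (2 * X), 0 < x := fun x hx => hX.trans_le hx.1
  have hd1 : ∀ t : ℝ, ∀ x ∈ Set.Icc X (2 * X),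
      HasDerivAt (fun x : ℝ => t * x ^ α) (t * (α * x ^ (α - 1))) x := fun t x hx =>
    (Real.hasDerivAt_rpow_const (Or.inl (hpos x hx).ne')).const_mul t
  have hd2 : ∀ t : ℝ, ∀ x ∈ Set.Icc X (2 * X),
      HasDerivAt (fun x : ℝ => t * (α * x ^ (α - 1))) (t * (α * (α - 1)) * x ^ (α - 2)) x := by
    intro t x hx
    refine (((Real.hasDerivAt_rpow_const (p := α - 1)
      (Or.inl (hpos x hx).ne')).const_mul α).const_mul t).congr_deriv ?_
    rw [show α - 1 - 1 = α - 2 by ring]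
    ring
  have hup : ∀ x ∈ Set.Icc X (2 * X), x ^ (α - 2) ≤ X ^ (α - 2) := fun x hx =>
    Real.rpow_le_rpow_of_nonpos hX hx.1 (by linarith)
  have hlow : ∀ x ∈ Set.Icc X (2 * X), X ^ (α - 2) / 4 ≤ x ^ (α - 2) := by
    intro x hx
    have h1 : (2 * X) ^ (α - 2) ≤ x ^ (α - 2) :=
      Real.rpow_le_rpow_of_nonpos (hpos x hx) hx.2 (by linarith)
    rw [Real.mul_rpow (by norm_num) hX.le] at h1
    have h2 : (1 / 4 : ℝ) ≤ 2 ^ (α - 2) := by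
      have : (2 : ℝ) ^ (-2 : ℝ) ≤ 2 ^ (α - 2) :=
        Real.rpow_le_rpow_of_exponent_le (by norm_num) (by linarith)
      refine le_trans (le_of_eq ?_) this
      rw [Real.rpow_neg (by norm_num)]
      norm_num
    have h3 : 0 < X ^ (α - 2) := by positivity
    nlinarith
  have hT : 0 ≤ (q - p) * (r - q) * (r - p) := by
    have h1 : 0 < q - p := by linarith
    have h2 : 0 < r - q := by linarith
    have h3 : 0 < r - p := by linarith
    positivity
  have hW : 0 < A * X ^ (α - 2) := by positivity
  have key : ∀ t : ℝ, 0 ≤ t * (α * (α - 1)) →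
      t * (α * (α - 1)) / 8 * X ^ (α - 2) * ((q - p) * (r - q) * (r - p)) ≤
        (q - p) * (t * r ^ α) - (r - p) * (t * q ^ α) + (r - q) * (t * p ^ α) ∧
      (q - p) * (t * r ^ α) - (r - p) * (t * q ^ α) + (r - q) * (t * p ^ α) ≤
        t * (α * (α - 1)) / 2 * X ^ (α - 2) * ((q - p) * (r - q) * (r - p)) := by
    intro t ht
    have h1 := second_difference_lower_bound (hd1 t) (hd2 t)
      (l := t * (α * (α - 1)) * (X ^ (α - 2) / 4))
      (fun x hx => mul_le_mul_of_nonneg_left (hlow x hx) ht) hp hpq hqr hr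
    have h2 := second_difference_lower_bound (hd1 (-t)) (hd2 (-t))
      (l := -(t * (α * (α - 1)) * X ^ (α - 2)))
      (fun x hx => by
        have := mul_le_mul_of_nonneg_left (hup x hx) ht
        linarith) hp hpq hqr hr
    constructor <;> nlinarith
  rcases le_total 0 (α * (α - 1)) with h | h
  · obtain ⟨h1, h2⟩ := key A (by positivity)
    rw [abs_of_nonneg h, abs_of_nonneg]
    · constructor <;> linarith
    · refine le_trans ?_ h1
      positivity
  · obtain ⟨h1, h2⟩ := key (-A) (by nlinarith)
    rw [abs_of_nonpos h, abs_of_nonpos]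
    · constructor <;> linarith
    · have : 0 ≤ -A * (α * (α - 1)) / 8 * X ^ (α - 2) * ((q - p) * (r - q) * (r - p)) := by
        have : 0 ≤ -A * (α * (α - 1)) := by nlinarith
        positivity
      linarith

/-- Three integer points close to a curve of small second difference in a short interval are
collinear, which forces them to be close together. -/
lemma gap_mul_gap_le {f : ℕ → ℝ} {ν : ℕ → ℕ} {κ ω Δ : ℝ} (hκ : 0 < κ) (hω : 0 < ω)
    (hΔω : Δ ≤ ω) (hΔω3 : Δ ≤ ω ^ 3) {p q r : ℕ} (hpq : p < q) (hqr : q < r)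
    (hν : ∀ m ∈ ({p, q, r} : Set ℕ), f m ≤ ν m ∧ (ν m : ℝ) ≤ f m + Δ)
    (hlow : κ / 8 * ω ^ 3 * (((q : ℝ) - p) * (r - q) * (r - p)) ≤
      |((q : ℝ) - p) * f r - (r - p) * f q + (r - q) * f p|)
    (hup : |((q : ℝ) - p) * f r - (r - p) * f q + (r - q) * f p| ≤
      κ / 2 * ω ^ 3 * (((q : ℝ) - p) * (r - q) * (r - p)))
    (hshort : ((r : ℝ) - p) * ((κ + 2) * ω) < 1) :
    ((q : ℝ) - p) * (r - q) ≤ 8 / κ := by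
  obtain ⟨hp1, hp2⟩ := hν p (by simp)
  obtain ⟨hq1, hq2⟩ := hν q (by simp)
  obtain ⟨hr1, hr2⟩ := hν r (by simp)
  have ha : (0 : ℝ) < q - p := sub_pos.2 (by exact_mod_cast hpq)
  have hb : (0 : ℝ) < r - q := sub_pos.2 (by exact_mod_cast hqr)
  have hc : (0 : ℝ) < r - p := by linarith
  set E : ℝ := ((q : ℝ) - p) * f r - (r - p) * f q + (r - q) * f p with hE
  set D : ℤ := ((q : ℤ) - p) * ν r - (r - p) * ν q + (r - q) * ν p with hD
  have hDc : (D : ℝ) = ((q : ℝ) - p) * ν r - (r - p) * ν q + (r - q) * ν p := by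
    simp [hD]
  have hDE : |(D : ℝ) - E| ≤ (r - p) * Δ := by
    have e : (D : ℝ) - E = ((q : ℝ) - p) * (ν r - f r) - (r - p) * (ν q - f q) +
        (r - q) * (ν p - f p) := by rw [hDc, hE]; ring
    have a1 := mul_nonneg ha.le (sub_nonneg.2 hr1)
    have a2 := mul_nonneg hc.le (sub_nonneg.2 hq1)
    have a3 := mul_nonneg hb.le (sub_nonneg.2 hp1)
    have b1 := mul_le_mul_of_nonneg_left (sub_le_iff_le_add'.2 hr2) ha.le
    have b2 := mul_le_mul_of_nonneg_left (sub_le_iff_le_add'.2 hq2) hc.le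
    have b3 := mul_le_mul_of_nonneg_left (sub_le_iff_le_add'.2 hp2) hb.le
    rw [e, abs_le]
    constructor <;> linarith
  have hD0 : D = 0 := by
    set L : ℝ := ((r : ℝ) - p) * ω with hL
    have hL0 : 0 < L := by positivity
    have hLs : L * (κ + 2) < 1 := by rw [hL]; linarith
    have hΔ2 : (r - p) * Δ < 1 / 2 := by
      have : (r - p) * Δ ≤ L := mul_le_mul_of_nonneg_left hΔω hc.le
      have : 0 < L * κ := by positivity
      linarith
    have hE2 : |E| < 1 / 2 := by
      have hT : ((q : ℝ) - p) * (r - q) ≤ (r - p) ^ 2 := by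
        have := mul_nonneg ha.le ha.le
        have := mul_nonneg ha.le hb.le
        have := mul_nonneg hb.le hb.le
        linarith
      have h1 : |E| ≤ κ / 2 * L ^ 3 := by
        refine hup.trans ?_
        have h2 := mul_le_mul_of_nonneg_left hT
          (show 0 ≤ κ / 2 * ω ^ 3 * (r - p) by positivity)
        rw [hL]
        linarith
      have h2 : 0 < κ * L := by positivity
      have h3 : κ * L < 1 := by linarith
      have h5 : L ^ 2 ≤ 1 := pow_le_one₀ hL0.le (by linarith)
      have h6 : κ * L * L ^ 2 ≤ κ * L := mul_le_of_le_one_right h2.le h5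
      linarith
    have h : |(D : ℝ)| < 1 := by
      have := abs_add_le ((D : ℝ) - E) E
      rw [sub_add_cancel] at this
      linarith
    exact Int.abs_lt_one_iff.1 (by exact_mod_cast h)
  rw [hD0, Int.cast_zero, zero_sub, abs_neg] at hDE
  have h := hlow.trans (hDE.trans (mul_le_mul_of_nonneg_left hΔω3 hc.le))
  rw [le_div_iff₀ hκ]
  have h2 : (((q : ℝ) - p) * (r - q) * κ) * (ω ^ 3 * (r - p)) ≤ 8 * (ω ^ 3 * (r - p)) := by
    linarith
  exact le_of_mul_le_mul_right h2 (by positivity)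

/-- A finite set of naturals in which any three elements have bounded product of gaps is small. -/
lemma card_le_of_gap_mul_gap_le {S : Finset ℕ} {B : ℕ}
    (h : ∀ p ∈ S, ∀ q ∈ S, ∀ r ∈ S, p < q → q < r → (q - p) * (r - q) ≤ B) :
    S.card ≤ B + 2 := by
  rcases S.eq_empty_or_nonempty with rfl | hS
  · simp
  have hsub : S ⊆ insert (S.max' hS) (Finset.Icc (S.min' hS) (S.min' hS + B)) := by
    intro q hq
    rw [Finset.mem_insert, Finset.mem_Icc]
    have h1 := S.min'_le q hq
    have h2 := S.le_max' q hq
    rcases h2.eq_or_lt with h2 | h2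
    · exact Or.inl h2
    refine Or.inr ⟨h1, ?_⟩
    rcases h1.eq_or_lt with h1 | h1
    · omega
    have h3 := h _ (S.min'_mem hS) q hq _ (S.max'_mem hS) h1 h2
    have h4 : (q - S.min' hS) * 1 ≤ (q - S.min' hS) * (S.max' hS - q) :=
      Nat.mul_le_mul_left _ (by omega)
    omega
  refine (Finset.card_le_card hsub).trans ((Finset.card_insert_le _ _).trans ?_)
  simp
  omega

/-- Splitting a dyadic interval into windows of length `1 / t`. -/
lemma card_le_of_windows {S : Finset ℕ} {B : ℕ} {X t : ℝ} (hX : 0 < X) (ht : 0 < t)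
    (hS : ∀ m ∈ S, X ≤ m ∧ (m : ℝ) ≤ 2 * X)
    (h : ∀ p ∈ S, ∀ q ∈ S, ∀ r ∈ S, p < q → q < r → ((r : ℝ) - p) * t < 1 →
      (q - p) * (r - q) ≤ B) :
    (S.card : ℝ) ≤ (B + 2) * (X * t + 2) := by
  have h1 : S.card ≤ (B + 2) * (S.image fun m : ℕ => ⌊(m : ℝ) * t⌋).card := by
    refine Finset.card_le_mul_card_image S _ fun k _ => card_le_of_gap_mul_gap_le ?_
    intro p hp q hq r hr hpq hqr
    rw [Finset.mem_filter] at hp hq hr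
    refine h p hp.1 q hq.1 r hr.1 hpq hqr ?_
    have hpk := Int.floor_le ((p : ℝ) * t)
    have hrk := Int.lt_floor_add_one ((r : ℝ) * t)
    rw [hp.2] at hpk
    rw [hr.2] at hrk
    linarith
  have h2 : (S.image fun m : ℕ => ⌊(m : ℝ) * t⌋) ⊆ Finset.Icc ⌊X * t⌋ ⌊2 * X * t⌋ := by
    intro k hk
    obtain ⟨m, hm, rfl⟩ := Finset.mem_image.1 hk
    rw [Finset.mem_Icc]
    exact ⟨Int.floor_le_floor (mul_le_mul_of_nonneg_right (hS m hm).1 ht.le),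
      Int.floor_le_floor (mul_le_mul_of_nonneg_right (hS m hm).2 ht.le)⟩
  have h3 := Finset.card_le_card h2
  rw [Int.card_Icc] at h3
  have h4 : ((⌊2 * X * t⌋ + 1 - ⌊X * t⌋).toNat : ℝ) ≤ X * t + 2 := by
    have hle : ⌊X * t⌋ ≤ ⌊2 * X * t⌋ := Int.floor_le_floor (by nlinarith)
    have e : ((⌊2 * X * t⌋ + 1 - ⌊X * t⌋).toNat : ℤ) = ⌊2 * X * t⌋ + 1 - ⌊X * t⌋ :=
      Int.toNat_of_nonneg (by omega)
    have e' : ((⌊2 * X * t⌋ + 1 - ⌊X * t⌋).toNat : ℝ) = ⌊2 * X * t⌋ + 1 - ⌊X * t⌋ := by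
      exact_mod_cast e
    rw [e']
    have := Int.floor_le (2 * X * t)
    have := Int.lt_floor_add_one (X * t)
    linarith
  have h5 : ((S.image fun m : ℕ => ⌊(m : ℝ) * t⌋).card : ℝ) ≤ X * t + 2 :=
    le_trans (by exact_mod_cast h3) h4
  calc (S.card : ℝ) ≤ (B + 2) * ((S.image fun m : ℕ => ⌊(m : ℝ) * t⌋).card : ℝ) := by
        exact_mod_cast h1
    _ ≤ _ := by gcongr

/-- A solution of `⌊n ^ c⌋ = s * m ^ 2` is an integer point close to a curve. -/
lemma near_curve_of_floor_rpow_eq {c : ℝ} (hc : 1 < c) {s n m : ℕ} (hs : 0 < s) (hm : 0 < m)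
    (h : ⌊(n : ℝ) ^ c⌋ = (s : ℤ) * (m : ℤ) ^ 2) :
    (s : ℝ) ^ (1 / c) * (m : ℝ) ^ (2 * (1 / c)) ≤ n ∧
      (n : ℝ) ≤ (s : ℝ) ^ (1 / c) * (m : ℝ) ^ (2 * (1 / c)) +
        1 / c * ((s : ℝ) ^ (1 / c - 1) * (m : ℝ) ^ (2 * (1 / c) - 2)) := by
  have hc0 : 0 < c := by linarith
  have hs' : (0 : ℝ) < s := by exact_mod_cast hs
  have hm' : (0 : ℝ) < m := by exact_mod_cast hm
  set γ : ℝ := 1 / c with hγ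
  have hγ0 : 0 < γ := by positivity
  have hγ1 : γ ≤ 1 := by rw [hγ, div_le_one hc0]; exact hc.le
  set y : ℝ := s * (m : ℝ) ^ (2 : ℝ) with hy
  have hy0 : 0 < y := by positivity
  have hyc : (((s : ℤ) * (m : ℤ) ^ 2 : ℤ) : ℝ) = y := by
    rw [hy, Real.rpow_two]; push_cast; ring
  have h1 : y ≤ (n : ℝ) ^ c := by rw [← hyc, ← h]; exact Int.floor_le _
  have h2 : (n : ℝ) ^ c < y + 1 := by rw [← hyc, ← h]; exact Int.lt_floor_add_one _
  have hn : ((n : ℝ) ^ c) ^ γ = n := by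
    rw [← Real.rpow_mul (Nat.cast_nonneg n), hγ, mul_one_div_cancel hc0.ne', Real.rpow_one]
  have hyp : ∀ t : ℝ, y ^ t = (s : ℝ) ^ t * (m : ℝ) ^ (2 * t) := fun t => by
    rw [hy, Real.mul_rpow hs'.le (by positivity), ← Real.rpow_mul hm'.le]
  constructor
  · rw [← hyp, ← hn]
    exact Real.rpow_le_rpow hy0.le h1 hγ0.le
  · rw [show 2 * γ - 2 = 2 * (γ - 1) by ring, ← hyp, ← hyp, ← hn]
    calc ((n : ℝ) ^ c) ^ γ ≤ (y + 1) ^ γ := Real.rpow_le_rpow (by positivity) h2.le hγ0.le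
      _ = (y * (1 + 1 / y)) ^ γ := by congr 1; field_simp
      _ = y ^ γ * (1 + 1 / y) ^ γ := Real.mul_rpow hy0.le (by positivity)
      _ ≤ y ^ γ * (1 + γ * (1 / y)) := by
        gcongr
        exact rpow_one_add_le_one_add_mul_self
          (le_trans (by norm_num) (by positivity : 0 ≤ 1 / y)) hγ0.le hγ1
      _ = _ := by rw [Real.rpow_sub_one hy0.ne']; ring

/-- The number of solutions with `m` in a dyadic interval. -/
lemma card_dyadic_solutions_le {c : ℝ} (hc : 1 < c) (hc2 : c ≠ 2) {s N : ℕ} (hs : 0 < s)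
    {X : ℝ} (hX : 1 ≤ X) {S : Finset ℕ} (ν : ℕ → ℕ) (hne : S.Nonempty)
    (hS : ∀ m ∈ S, X ≤ m ∧ (m : ℝ) ≤ 2 * X)
    (hν : ∀ m ∈ S, ν m ≤ N ∧ ⌊(ν m : ℝ) ^ c⌋ = (s : ℤ) * (m : ℤ) ^ 2) :
    (S.card : ℝ) ≤ (⌊8 / |2 * (1 / c) * (2 * (1 / c) - 1)|⌋₊ + 2) *
      ((|2 * (1 / c) * (2 * (1 / c) - 1)| + 2) *
        ((s : ℝ) ^ (-(1 / 6) : ℝ) * (N : ℝ) ^ ((2 + c) / 6) + 1)) := by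
  have hc0 : 0 < c := by linarith
  have hs1 : (1 : ℝ) ≤ s := by exact_mod_cast hs
  have hs0 : (0 : ℝ) < s := by linarith
  have hX0 : 0 < X := by linarith
  set γ : ℝ := 1 / c with hγ
  have hγ0 : 0 < γ := by positivity
  have hγ1 : γ < 1 := by rw [hγ, div_lt_one hc0]; exact hc
  have hγ2 : 2 * γ - 1 ≠ 0 := by
    intro h0
    apply hc2
    rw [hγ] at h0
    field_simp at h0
    linarith
  set κ : ℝ := |2 * γ * (2 * γ - 1)| with hκ
  have hκ0 : 0 < κ := abs_pos.2 (mul_ne_zero (by positivity) hγ2)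
  set W : ℝ := (s : ℝ) ^ γ * X ^ (2 * γ - 2) with hW
  have hW0 : 0 < W := by positivity
  set ω : ℝ := W ^ (1 / 3 : ℝ) with hω
  have hω0 : 0 < ω := by positivity
  have hω3 : ω ^ 3 = W := by
    rw [hω, ← Real.rpow_natCast, ← Real.rpow_mul hW0.le]
    norm_num
  set d : ℝ := (s : ℝ) ^ (γ - 1) * X ^ (2 * γ - 2) with hd
  have hd0 : 0 < d := by positivity
  have hd1 : d ≤ 1 := mul_le_one₀ (Real.rpow_le_one_of_one_le_of_nonpos hs1 (by linarith))
    (by positivity) (Real.rpow_le_one_of_one_le_of_nonpos hX (by linarith))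
  have hdω3 : d ≤ ω ^ 3 := by
    rw [hω3, hd, hW]
    gcongr
    linarith
  have hdω : d ≤ ω := by
    rcases le_total ω 1 with h | h
    · exact hdω3.trans (pow_le_of_le_one hω0.le h (by norm_num))
    · exact hd1.trans h
  have hγd : γ * d ≤ d := mul_le_of_le_one_left hd0.le hγ1.le
  have hcurve : ∀ m ∈ S, (s : ℝ) ^ γ * (m : ℝ) ^ (2 * γ) ≤ ν m ∧
      (ν m : ℝ) ≤ (s : ℝ) ^ γ * (m : ℝ) ^ (2 * γ) + γ * d := by
    intro m hm
    have hm0 : (0 : ℝ) < m := hX0.trans_le (hS m hm).1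
    obtain ⟨h1, h2⟩ := near_curve_of_floor_rpow_eq hc hs (by exact_mod_cast hm0) (hν m hm).2
    refine ⟨h1, h2.trans ?_⟩
    have h3 : (m : ℝ) ^ (2 * γ - 2) ≤ X ^ (2 * γ - 2) :=
      Real.rpow_le_rpow_of_nonpos hX0 (hS m hm).1 (by linarith)
    rw [hd]
    gcongr
  have hcard : (S.card : ℝ) ≤ (⌊8 / κ⌋₊ + 2) * (X * ((κ + 2) * ω) + 2) := by
    refine card_le_of_windows hX0 (by positivity) hS ?_
    intro p hp q hq r hr hpq hqr hshort
    obtain ⟨h1, h2⟩ := abs_second_difference_rpow (α := 2 * γ) (A := (s : ℝ) ^ γ)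
      (by positivity) (by linarith) (by positivity) hX0 (hS p hp).1
      (Nat.cast_lt (α := ℝ).2 hpq) (Nat.cast_lt (α := ℝ).2 hqr) (hS r hr).2
    rw [← hW, ← hω3] at h1 h2
    have h3 := gap_mul_gap_le (f := fun m : ℕ => (s : ℝ) ^ γ * (m : ℝ) ^ (2 * γ)) (ν := ν)
      hκ0 hω0 (hγd.trans hdω) (hγd.trans hdω3) hpq hqr
      (by
        rintro m (rfl | rfl | rfl)
        exacts [hcurve _ hp, hcurve _ hq, hcurve _ hr]) h1 h2 hshort
    refine Nat.le_floor ?_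
    rw [Nat.cast_mul, Nat.cast_sub hpq.le, Nat.cast_sub hqr.le]
    exact h3
  have hXω : X * ω ≤ (s : ℝ) ^ (-(1 / 6) : ℝ) * (N : ℝ) ^ ((2 + c) / 6) := by
    obtain ⟨m, hm⟩ := hne
    have hsX : s * X ^ (2 : ℝ) ≤ (N : ℝ) ^ c := by
      have h1 : ((s : ℝ) * (m : ℝ) ^ 2) ≤ (ν m : ℝ) ^ c := by
        have := Int.floor_le ((ν m : ℝ) ^ c)
        rw [(hν m hm).2] at this
        push_cast at this
        exact this
      have h2 : (ν m : ℝ) ^ c ≤ (N : ℝ) ^ c :=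
        Real.rpow_le_rpow (by positivity) (by exact_mod_cast (hν m hm).1) hc0.le
      refine le_trans ?_ (h1.trans h2)
      rw [Real.rpow_two]
      have := (hS m hm).1
      gcongr
    have hN0 : (0 : ℝ) ≤ N := Nat.cast_nonneg N
    have h1 : (s : ℝ) ^ (γ + 1 / 2) * X ^ (2 * (γ + 1 / 2)) ≤ (N : ℝ) ^ (c * (γ + 1 / 2)) := by
      rw [Real.rpow_mul hX0.le, ← Real.mul_rpow hs0.le (by positivity), Real.rpow_mul hN0]
      exact Real.rpow_le_rpow (by positivity) hsX (by positivity)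
    have h2 : (X * ω) ^ 3 = (s : ℝ) ^ (-(1 / 2) : ℝ) *
        ((s : ℝ) ^ (γ + 1 / 2) * X ^ (2 * (γ + 1 / 2))) := by
      rw [← mul_assoc, ← Real.rpow_add hs0, mul_pow, hω3, hW,
        show 2 * (γ + 1 / 2) = (2 * γ - 2) + (3 : ℕ) by push_cast; ring,
        Real.rpow_add hX0, Real.rpow_natCast,
        show -(1 / 2) + (γ + 1 / 2) = γ by ring]
      ring
    have h3 : ((s : ℝ) ^ (-(1 / 6) : ℝ) * (N : ℝ) ^ ((2 + c) / 6)) ^ 3 =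
        (s : ℝ) ^ (-(1 / 2) : ℝ) * (N : ℝ) ^ (c * (γ + 1 / 2)) := by
      rw [mul_pow, ← Real.rpow_natCast, ← Real.rpow_natCast, ← Real.rpow_mul hs0.le,
        ← Real.rpow_mul hN0]
      congr 2
      · norm_num
      · rw [hγ]; field_simp; push_cast; ring
    refine le_of_pow_le_pow_left₀ three_ne_zero (by positivity) ?_
    rw [h2, h3]
    gcongr
  refine hcard.trans ?_
  gcongr
  have := mul_le_mul_of_nonneg_left hXω (show 0 ≤ κ + 2 by positivity)
  linarith

/-- The second coordinates of the solutions determine them, and so `Qc` counts the values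
of `m`. -/
lemma exists_finset_card_eq_Qc {c : ℝ} (hc : 1 < c) {s N : ℕ} (hs : 0 < s) :
    ∃ (S : Finset ℕ) (ν : ℕ → ℕ), S.card = Qc c s N ∧
      ∀ m ∈ S, 0 < m ∧ ν m ≤ N ∧ ⌊(ν m : ℝ) ^ c⌋ = (s : ℤ) * (m : ℤ) ^ 2 := by
  set P : Set (ℕ × ℕ) := {p : ℕ × ℕ | 0 < p.1 ∧ p.1 ≤ N ∧ 0 < p.2 ∧
    ⌊(p.1 : ℝ) ^ c⌋ = (s : ℤ) * (p.2 : ℤ) ^ 2} with hP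
  have hc0 : 0 < c := by linarith
  have hfin : P.Finite := by
    refine Set.Finite.of_injOn (f := Prod.fst) (t := Set.Icc 0 N)
      (fun p hp => ⟨Nat.zero_le _, hp.2.1⟩) ?_ (Set.finite_Icc 0 N)
    rintro ⟨n, m⟩ hp ⟨n', m'⟩ hp' (rfl : n = n')
    have h := hp.2.2.2.symm.trans hp'.2.2.2
    have h1 : s * m ^ 2 = s * m' ^ 2 := by exact_mod_cast h
    have h2 : m ^ 2 = m' ^ 2 := Nat.eq_of_mul_eq_mul_left hs h1
    have h3 : m = m' := Nat.pow_left_injective two_ne_zero h2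
    rw [h3]
  have hinj : Set.InjOn Prod.snd P := by
    rintro ⟨n, m⟩ hp ⟨n', m'⟩ hp' (rfl : m = m')
    obtain ⟨-, -, hm, h⟩ := hp
    obtain ⟨-, -, -, h'⟩ := hp'
    dsimp only at hm h h'
    obtain ⟨h1, h2⟩ := near_curve_of_floor_rpow_eq hc hs hm h
    obtain ⟨h1', h2'⟩ := near_curve_of_floor_rpow_eq hc hs hm h'
    have hγ1 : 1 / c < 1 := by rw [div_lt_one hc0]; exact hc
    have hγ0 : 0 < 1 / c := by positivity
    have hs1 : (1 : ℝ) ≤ s := by exact_mod_cast hs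
    have hm1 : (1 : ℝ) ≤ m := by exact_mod_cast hm
    have hd1 : (s : ℝ) ^ (1 / c - 1) * (m : ℝ) ^ (2 * (1 / c) - 2) ≤ 1 :=
      mul_le_one₀ (Real.rpow_le_one_of_one_le_of_nonpos hs1 (by linarith))
        (by positivity) (Real.rpow_le_one_of_one_le_of_nonpos hm1 (by linarith))
    have hd := mul_le_of_le_one_right hγ0.le hd1
    have e1 : (n : ℝ) < n' + 1 := by linarith
    have e2 : (n' : ℝ) < n + 1 := by linarith
    have e1' : n < n' + 1 := by exact_mod_cast e1
    have e2' : n' < n + 1 := by exact_mod_cast e2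
    rw [show n = n' by omega]
  have hex : ∀ m, ∃ n, m ∈ Prod.snd '' P → (n, m) ∈ P := by
    intro m
    by_cases h : m ∈ Prod.snd '' P
    · obtain ⟨⟨n, m'⟩, hp, rfl⟩ := h
      exact ⟨n, fun _ => hp⟩
    · exact ⟨0, fun h' => absurd h' h⟩
  choose ν hν using hex
  refine ⟨(hfin.image Prod.snd).toFinset, ν, ?_, ?_⟩
  · rw [← Set.ncard_eq_toFinset_card _ (hfin.image Prod.snd), hinj.ncard_image, Qc]
  · intro m hm
    have h := hν m ((Set.Finite.mem_toFinset _).1 hm)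
    exact ⟨h.2.2.1, h.2.1, h.2.2.2⟩

/-- The upper bound for `Qc`. -/
lemma exists_Qc_le {c : ℝ} (hc : 1 < c) (hc2 : c ≠ 2) {ε : ℝ} (hε : 0 < ε) :
    ∃ C : ℝ, ∀ s N : ℕ, 0 < s → 2 ≤ N →
      (Qc c s N : ℝ) ≤
        C * ((s : ℝ) ^ (-(1/6) : ℝ) * (N : ℝ) ^ ((2 + c)/6 + ε) + (N : ℝ) ^ (1/2 + ε)) := by
  set K : ℝ := (⌊8 / |2 * (1 / c) * (2 * (1 / c) - 1)|⌋₊ + 2) *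
    (|2 * (1 / c) * (2 * (1 / c) - 1)| + 2) with hK
  have hK0 : 0 ≤ K := by positivity
  have hc0 : 0 < c := by linarith
  have hlog2 : 0 < Real.log 2 := Real.log_pos (by norm_num)
  refine ⟨(c / (ε * Real.log 2) + 1) * K, fun s N hs hN => ?_⟩
  have hN1 : (1 : ℝ) ≤ N := by exact_mod_cast (by omega : 1 ≤ N)
  have hN0 : (0 : ℝ) < N := by linarith
  have hs1 : (1 : ℝ) ≤ s := by exact_mod_cast hs
  obtain ⟨S, ν, hcard, hS⟩ := exists_finset_card_eq_Qc (N := N) hc hs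
  set R : ℝ := (s : ℝ) ^ (-(1 / 6) : ℝ) * (N : ℝ) ^ ((2 + c) / 6) with hR
  have hR0 : 0 ≤ R := by positivity
  have hblock : ∀ k ∈ S.image (Nat.log 2),
      (((S.filter fun m => Nat.log 2 m = k).card : ℕ) : ℝ) ≤ K * (R + 1) := by
    intro k hk
    have hne : (S.filter fun m => Nat.log 2 m = k).Nonempty := by
      obtain ⟨m, hm, hmk⟩ := Finset.mem_image.1 hk
      exact ⟨m, Finset.mem_filter.2 ⟨hm, hmk⟩⟩
    rw [hK, mul_assoc]
    refine card_dyadic_solutions_le hc hc2 hs (X := 2 ^ k) (one_le_pow₀ (by norm_num)) ν hne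
      ?_ fun m hm => (hS m (Finset.mem_filter.1 hm).1).2
    intro m hm
    obtain ⟨hmS, rfl⟩ := Finset.mem_filter.1 hm
    constructor
    · exact_mod_cast Nat.pow_log_le_self 2 (hS m hmS).1.ne'
    · have := (Nat.lt_pow_succ_log_self one_lt_two m).le
      rw [pow_succ'] at this
      exact_mod_cast this
  have himage : ((S.image (Nat.log 2)).card : ℝ) ≤
      (c / (ε * Real.log 2) + 1) * (N : ℝ) ^ ε := by
    have hsub : S.image (Nat.log 2) ⊆
        Finset.range (⌊c * Real.log N / Real.log 2⌋₊ + 1) := by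
      intro k hk
      obtain ⟨m, hm, rfl⟩ := Finset.mem_image.1 hk
      obtain ⟨hm0, hn, h⟩ := hS m hm
      rw [Finset.mem_range, Nat.lt_succ_iff]
      refine Nat.le_floor ?_
      have h0 : (m : ℝ) ≤ (N : ℝ) ^ c := by
        have hm1 : (1 : ℝ) ≤ m := by exact_mod_cast hm0
        have h1 := Int.floor_le ((ν m : ℝ) ^ c)
        rw [h] at h1
        push_cast at h1
        have h2 : (ν m : ℝ) ^ c ≤ (N : ℝ) ^ c :=
          Real.rpow_le_rpow (by positivity) (by exact_mod_cast hn) hc0.le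
        have h3 : (m : ℝ) ^ 2 ≤ s * (m : ℝ) ^ 2 := le_mul_of_one_le_left (by positivity) hs1
        have h4 : (m : ℝ) ≤ (m : ℝ) ^ 2 := le_self_pow₀ hm1 two_ne_zero
        linarith
      have h1 : (2 : ℝ) ^ Nat.log 2 m ≤ (N : ℝ) ^ c :=
        le_trans (by exact_mod_cast Nat.pow_log_le_self 2 hm0.ne') h0
      have h2 := Real.log_le_log (by positivity) h1
      rw [Real.log_pow, Real.log_rpow hN0] at h2
      rwa [le_div_iff₀ hlog2]
    have h1 := Finset.card_le_card hsub
    rw [Finset.card_range] at h1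
    have h2 : ((S.image (Nat.log 2)).card : ℝ) ≤ c * Real.log N / Real.log 2 + 1 := by
      refine le_trans (b := ((⌊c * Real.log N / Real.log 2⌋₊ + 1 : ℕ) : ℝ))
        (by exact_mod_cast h1) ?_
      push_cast
      gcongr
      exact Nat.floor_le (div_nonneg (mul_nonneg hc0.le (Real.log_nonneg hN1)) hlog2.le)
    have h3 : c * Real.log N / Real.log 2 ≤ c / (ε * Real.log 2) * (N : ℝ) ^ ε := by
      calc c * Real.log N / Real.log 2 ≤ c * ((N : ℝ) ^ ε / ε) / Real.log 2 := by
            gcongr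
            exact Real.log_le_rpow_div hN0.le hε
        _ = _ := by field_simp
    have h4 : (1 : ℝ) ≤ (N : ℝ) ^ ε := Real.one_le_rpow hN1 hε.le
    linarith
  have hsum : (S.card : ℝ) ≤ ((S.image (Nat.log 2)).card : ℝ) * (K * (R + 1)) := by
    rw [Finset.card_eq_sum_card_image (Nat.log 2) S, Nat.cast_sum, ← nsmul_eq_mul]
    exact Finset.sum_le_card_nsmul _ _ _ hblock
  have hhalf : (1 : ℝ) ≤ (N : ℝ) ^ (1 / 2 : ℝ) := Real.one_le_rpow hN1 (by norm_num)
  rw [← hcard]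
  calc (S.card : ℝ) ≤ ((S.image (Nat.log 2)).card : ℝ) * (K * (R + 1)) := hsum
    _ ≤ (c / (ε * Real.log 2) + 1) * (N : ℝ) ^ ε * (K * (R + (N : ℝ) ^ (1 / 2 : ℝ))) := by
      gcongr
    _ = _ := by rw [Real.rpow_add hN0, Real.rpow_add hN0, hR]; ring

theorem asymptotic_half_half (c : ℝ) (hc : 1 < c) (hc' : ∀ n : ℕ, c ≠ n) :
    ∀ ε : ℝ, 0 < ε →
      (∃ C : ℝ, ∀ s N : ℕ, 0 < s → 2 ≤ N →
        |(Qc c s N : ℝ) - (1/c) * (2 * (1/c) - 1)⁻¹ * (s : ℝ) ^ (-(1/2) : ℝ) *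
            (N : ℝ) ^ (1 - c/2)| ≤
          C * ((s : ℝ) ^ (-(1/6) : ℝ) * (N : ℝ) ^ ((2 + c)/6 + ε) + (N : ℝ) ^ (1/2 + ε))) ∧
      (∃ C' : ℝ, ∀ s N : ℕ, 0 < s → 2 ≤ N →
        (Qc c s N : ℝ) ≤
          C' * ((s : ℝ) ^ (-(1/6) : ℝ) * (N : ℝ) ^ ((2 + c)/6 + ε) + (N : ℝ) ^ (1/2 + ε))) := by
  intro ε hε
  obtain ⟨C, hC⟩ := exists_Qc_le hc (by exact_mod_cast hc' 2) hε
  refine ⟨⟨C + |(1/c) * (2 * (1/c) - 1)⁻¹|, fun s N hs hN => ?_⟩, C, hC⟩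
  have hN1 : (1 : ℝ) ≤ N := by exact_mod_cast (by omega : 1 ≤ N)
  have hs1 : (1 : ℝ) ≤ s := by exact_mod_cast hs
  have hmain : (s : ℝ) ^ (-(1/2) : ℝ) * (N : ℝ) ^ (1 - c/2) ≤
      (s : ℝ) ^ (-(1/6) : ℝ) * (N : ℝ) ^ ((2 + c)/6 + ε) + (N : ℝ) ^ (1/2 + ε) := by
    refine le_trans ?_ (le_add_of_nonneg_right (by positivity))
    gcongr
    · norm_num
    · linarith
  refine (abs_sub _ _).trans ?_
  rw [Nat.abs_cast, add_mul, mul_assoc (1 / c * (2 * (1 / c) - 1)⁻¹), abs_mul,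
    abs_of_nonneg (show 0 ≤ (s : ℝ) ^ (-(1/2) : ℝ) * (N : ℝ) ^ (1 - c/2) by positivity)]
  exact add_le_add (hC s N hs hN) (mul_le_mul_of_nonneg_left hmain (abs_nonneg _))
end

section
/- For every real $c>1$ with $c\notin\mathbb{N}$ there exists a constant $\vartheta>0$ (depending only on $c$) such that the square-free parts of almost all integers $\lfloor n^c\rfloor$ with $1\le n\le N$ exceed $N^{\vartheta}$. Precisely: for every $\delta>0$ there exists $N_0$ such that for all integers $N\ge N_0$, the number of integers $n$ with $1\le n\le N$ for which there exist a squarefree positive integer $s\le N^{\vartheta}$ and a positive integer $m$ with $\lfloor n^c\rfloor = s m^2$ is at most $\delta N$. -/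
open Finset Filter Topology

/-- Iterated Rolle theorem: if `F (j + 1)` is the derivative of `F j` and `F 0` has `k + 1` zeros,
then `F k` has a zero. -/
lemma exists_iterated_rolle {S : Set ℝ} (hS : S.OrdConnected) (k : ℕ) (F : ℕ → ℝ → ℝ)
    (hF : ∀ j, ∀ x ∈ S, HasDerivAt (F j) (F (j + 1) x) x)
    (x : Fin (k + 1) → ℝ) (hx : StrictMono x) (hxS : ∀ i, x i ∈ S) (hx0 : ∀ i, F 0 (x i) = 0) :
    ∃ ξ ∈ S, F k ξ = 0 := by
  induction k generalizing F with
  | zero => exact ⟨x 0, hxS 0, hx0 0⟩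
  | succ k ih =>
    have rolle : ∀ i : Fin (k + 1), ∃ y ∈ Set.Ioo (x i.castSucc) (x i.succ), F 1 y = 0 := by
      intro i
      have hsub : Set.Icc (x i.castSucc) (x i.succ) ⊆ S := hS.out (hxS _) (hxS _)
      exact exists_hasDerivAt_eq_zero (hx i.castSucc_lt_succ)
        (fun y hy => (hF 0 y (hsub hy)).continuousAt.continuousWithinAt)
        ((hx0 _).trans (hx0 _).symm) fun y hy => hF 0 y (hsub (Set.Ioo_subset_Icc_self hy))
    choose y hy hy0 using rolle
    refine ih (fun j => F (j + 1)) (fun j => hF (j + 1)) y ?_ ?_ hy0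
    · intro i j hij
      exact (hy i).2.trans_le ((hx.monotone (by simpa using hij)).trans (hy j).1.le)
    · exact fun i => hS.out (hxS _) (hxS _) (Set.Ioo_subset_Icc_self (hy i))

/-- Mean value theorem for divided differences. -/
lemma exists_dividedDifference_eq {S : Set ℝ} (hS : S.OrdConnected) (k : ℕ) (F : ℕ → ℝ → ℝ)
    (hF : ∀ j, ∀ x ∈ S, HasDerivAt (F j) (F (j + 1) x) x)
    (t : Finset ℝ) (ht : #t = k + 1) (htS : ∀ x ∈ t, x ∈ S) :
    ∃ ξ ∈ S, F k ξ = k.factorial * ∑ x ∈ t, F 0 x / ∏ y ∈ t.erase x, (x - y) := by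
  set P := Lagrange.interpolate t id (F 0)
  have hinj : Set.InjOn (id : ℝ → ℝ) t := Function.injective_id.injOn
  obtain ⟨ξ, hξ, h⟩ := exists_iterated_rolle hS k
    (fun j x => F j x - (Polynomial.derivative^[j] P).eval x)
    (fun j x hx => by
      have := (Polynomial.derivative^[j] P).hasDerivAt x
      rw [← Function.iterate_succ_apply' Polynomial.derivative] at this
      exact (hF j x hx).sub this)
    (t.orderEmbOfFin ht) (t.orderEmbOfFin ht).strictMono
    (fun i => htS _ (t.orderEmbOfFin_mem ht i))
    (fun i => by
      have := Lagrange.eval_interpolate_at_node (F 0) hinj (t.orderEmbOfFin_mem ht i)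
      simp only [id] at this
      simp only [Function.iterate_zero, id, P, this, sub_self])
  refine ⟨ξ, hξ, ?_⟩
  rw [sub_eq_zero] at h
  rw [h, Lagrange.iterate_derivative_interpolate _ hinj (by omega), ht]
  simp [Polynomial.eval_finsetSum]

lemma exists_dividedDifference_rpow_eq {X Y : ℝ} (hX : 0 < X) (α : ℝ) (k : ℕ)
    (t : Finset ℕ) (ht : #t = k + 1) (htX : ∀ n ∈ t, X ≤ n ∧ (n : ℝ) ≤ Y) :
    ∃ ξ ∈ Set.Icc X Y, (descPochhammer ℝ k).eval α * ξ ^ (α - k) =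
      k.factorial * ∑ n ∈ t, (n : ℝ) ^ α / ∏ j ∈ t.erase n, ((n : ℝ) - j) := by
  have hinj : Function.Injective ((↑) : ℕ → ℝ) := Nat.cast_injective
  obtain ⟨ξ, hξ, h⟩ := exists_dividedDifference_eq (S := Set.Icc X Y) Set.ordConnected_Icc k
    (fun j x => (descPochhammer ℝ j).eval α * x ^ (α - j))
    (fun j x hx => by
      have := (Real.hasDerivAt_rpow_const (x := x) (p := α - j)
        (Or.inl (hX.trans_le hx.1).ne')).const_mul ((descPochhammer ℝ j).eval α)
      rwa [← mul_assoc, ← descPochhammer_succ_eval, sub_sub, ← Nat.cast_succ] at this)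
    (t.image (↑)) (by rw [card_image_of_injective _ hinj, ht])
    (by simpa [Set.mem_Icc] using htX)
  refine ⟨ξ, hξ, ?_⟩
  rw [h, sum_image hinj.injOn]
  congr 1
  refine sum_congr rfl fun n _ => ?_
  rw [← image_erase hinj, prod_image hinj.injOn]
  simp

/-- If `k + 1` integers in a short interval have `n ^ α` very close to multiples of a common
`σ ≥ 1`, then the `k`-th derivative of `x ^ α` is either not small or extremely small. -/
lemma one_le_or_le_of_rpow_near_multiples {X Y L σ α : ℝ} {k : ℕ} (hX : 0 < X) (hL : 1 ≤ L)
    (hσ : 1 ≤ σ) (hαk : α ≤ k) (t : Finset ℕ) (ht : #t = k + 1)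
    (htX : ∀ n ∈ t, X ≤ n ∧ (n : ℝ) ≤ Y) (htL : ∀ i ∈ t, ∀ j ∈ t, |(i : ℝ) - j| ≤ L)
    (m : ℕ → ℤ) (hm : ∀ n ∈ t, |(n : ℝ) ^ α - σ * m n| ≤ X ^ (-α)) :
    1 ≤ L ^ (k * (k + 1)) *
        (|(descPochhammer ℝ k).eval α| / k.factorial * X ^ (α - k) + (k + 1) * X ^ (-α)) ∨
      |(descPochhammer ℝ k).eval α| / k.factorial * Y ^ (α - k) ≤ (k + 1) * X ^ (-α) := by
  set b := |(descPochhammer ℝ k).eval α| / k.factorial with hb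
  have hb0 : 0 ≤ b := by positivity
  obtain ⟨ξ, ⟨hξX, hξY⟩, hξ⟩ := exists_dividedDifference_rpow_eq hX α k t ht htX
  have hξ0 : 0 < ξ := hX.trans_le hξX
  have hfac : (0 : ℝ) < k.factorial := by positivity
  let d : ℕ → ℤ := fun n => ∏ j ∈ t.erase n, ((n : ℤ) - j)
  have hd : ∀ n, d n ≠ 0 := fun n => prod_ne_zero_iff.2 fun j hj => by
    have := ne_of_mem_erase hj
    omega
  have hdcast : ∀ n, ((d n : ℤ) : ℝ) = ∏ j ∈ t.erase n, ((n : ℝ) - j) := fun n => by simp [d]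
  have hd1 : ∀ n, 1 ≤ |(d n : ℝ)| := fun n => by
    exact_mod_cast Int.one_le_abs (hd n)
  have hdL : ∀ n ∈ t, |(d n : ℝ)| ≤ L ^ k := fun n hn => by
    rw [hdcast, abs_prod]
    calc _ ≤ ∏ j ∈ t.erase n, L :=
          prod_le_prod (fun _ _ => abs_nonneg _) fun j hj => htL n hn j (mem_of_mem_erase hj)
      _ = L ^ k := by rw [prod_const, card_erase_of_mem hn, ht]; rfl
  have hsum : |∑ n ∈ t, (n : ℝ) ^ α / d n| = b * ξ ^ (α - k) := by
    have : ∑ n ∈ t, (n : ℝ) ^ α / d n =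
        (descPochhammer ℝ k).eval α * ξ ^ (α - k) / k.factorial := by
      rw [hξ, mul_div_cancel_left₀ _ hfac.ne']
      simp only [hdcast]
    rw [this, abs_div, abs_mul, abs_of_pos (Real.rpow_pos_of_pos hξ0 _), abs_of_pos hfac]
    ring
  have hdiff : |∑ n ∈ t, (n : ℝ) ^ α / d n - σ * ∑ n ∈ t, (m n : ℝ) / d n| ≤
      (k + 1) * X ^ (-α) := by
    rw [mul_sum, ← sum_sub_distrib]
    calc _ ≤ ∑ n ∈ t, |(n : ℝ) ^ α / d n - σ * ((m n : ℝ) / d n)| := abs_sum_le_sum_abs _ _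
      _ ≤ ∑ n ∈ t, X ^ (-α) := sum_le_sum fun n hn => by
          rw [← mul_div_assoc, ← sub_div, abs_div]
          exact (div_le_self (abs_nonneg _) (hd1 n)).trans (hm n hn)
      _ = _ := by rw [sum_const, ht, nsmul_eq_mul]; push_cast; rfl
  let A : ℤ := ∑ n ∈ t, m n * ∏ i ∈ t.erase n, d i
  let V : ℤ := ∏ n ∈ t, d n
  have hAV : (A : ℝ) = V * ∑ n ∈ t, (m n : ℝ) / d n := by
    rw [mul_sum]
    simp only [A, V, Int.cast_sum, Int.cast_mul, Int.cast_prod]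
    refine sum_congr rfl fun n hn => ?_
    rw [← mul_prod_erase t (fun i => (d i : ℝ)) hn]
    have : (d n : ℝ) ≠ 0 := by exact_mod_cast hd n
    field_simp
  have hV0 : (V : ℝ) ≠ 0 := by
    exact_mod_cast prod_ne_zero_iff.2 fun n _ => hd n
  have hVL : |(V : ℝ)| ≤ L ^ (k * (k + 1)) := by
    simp only [V, Int.cast_prod]
    rw [abs_prod]
    calc _ ≤ ∏ n ∈ t, L ^ k := prod_le_prod (fun _ _ => abs_nonneg _) hdL
      _ = _ := by rw [prod_const, ht, ← pow_mul]
  by_cases hA : A = 0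
  · right
    have : ∑ n ∈ t, (m n : ℝ) / d n = 0 := by
      rw [hA, Int.cast_zero] at hAV
      exact (mul_eq_zero.1 hAV.symm).resolve_left hV0
    rw [this, mul_zero, sub_zero, hsum] at hdiff
    refine le_trans ?_ hdiff
    gcongr ?_ * ?_
    exact Real.rpow_le_rpow_of_nonpos hξ0 hξY (by linarith)
  · left
    have hA1 : (1 : ℝ) ≤ |(A : ℝ)| := by exact_mod_cast Int.one_le_abs hA
    have hξle : ξ ^ (α - k) ≤ X ^ (α - k) :=
      Real.rpow_le_rpow_of_nonpos hX hξX (by linarith)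
    have hQ : |σ * ∑ n ∈ t, (m n : ℝ) / d n| ≤ b * X ^ (α - k) + (k + 1) * X ^ (-α) := by
      have h1 := abs_sub_abs_le_abs_sub (σ * ∑ n ∈ t, (m n : ℝ) / d n)
        (∑ n ∈ t, (n : ℝ) ^ α / d n)
      rw [abs_sub_comm, hsum] at h1
      have h2 := mul_le_mul_of_nonneg_left hξle hb0
      linarith
    calc (1 : ℝ) ≤ σ * |(A : ℝ)| := by nlinarith
      _ = |(V : ℝ)| * |σ * ∑ n ∈ t, (m n : ℝ) / d n| := by
          rw [hAV, abs_mul, abs_mul, abs_of_pos (by linarith : 0 < σ)]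
          ring
      _ ≤ _ := by gcongr

lemma abs_rpow_sub_sqrt_mul_le {c X : ℝ} (hc : 0 ≤ c) (hX : 0 < X) {n s m : ℕ} (hn : X ≤ n)
    (h : ⌊(n : ℝ) ^ c⌋ = (s : ℤ) * (m : ℤ) ^ 2) :
    |(n : ℝ) ^ (c / 2) - √s * ((m : ℤ) : ℝ)| ≤ X ^ (-(c / 2)) := by
  obtain ⟨h1, h2⟩ := Int.floor_eq_iff.1 h
  push_cast at h1 h2
  have hn0 : (0 : ℝ) < n := hX.trans_le hn
  have hp : 0 < (n : ℝ) ^ (c / 2) := Real.rpow_pos_of_pos hn0 _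
  have hsq : (n : ℝ) ^ c = ((n : ℝ) ^ (c / 2)) ^ 2 := by
    rw [← Real.rpow_natCast, ← Real.rpow_mul hn0.le]
    norm_num
  have hs : (√(s : ℝ)) ^ 2 = s := Real.sq_sqrt (Nat.cast_nonneg s)
  have hb : 0 ≤ √(s : ℝ) * (m : ℝ) := by positivity
  have hXp : (0 : ℝ) < X ^ (c / 2) := Real.rpow_pos_of_pos hX _
  have hXn : X ^ (c / 2) ≤ (n : ℝ) ^ (c / 2) :=
    Real.rpow_le_rpow hX.le hn (by linarith)
  rw [Int.cast_natCast, Real.rpow_neg hX.le]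
  set a := (n : ℝ) ^ (c / 2)
  set q := √(s : ℝ) * (m : ℝ) with hq
  have hqq : (s : ℝ) * (m : ℝ) ^ 2 = q ^ 2 := by rw [hq, mul_pow, hs]
  rw [hqq, hsq] at h1 h2
  have hqa : q ≤ a := abs_le_of_sq_le_sq' h1 hp.le |>.2
  rw [abs_of_nonneg (by linarith), ← one_div, le_div_iff₀ hXp]
  nlinarith

lemma card_le_of_fibers_near_multiples {X L Z : ℝ} {N k : ℕ} (hL : 1 ≤ L) (hZ : 0 ≤ Z)
    {c : ℝ} (hc : 0 ≤ c) (hX : 0 < X) (hck : c / 2 ≤ k)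
    (hlarge : L ^ (k * (k + 1)) * (|(descPochhammer ℝ k).eval (c / 2)| / k.factorial *
      X ^ (c / 2 - k) + (k + 1) * X ^ (-(c / 2))) < 1)
    (hsmall : (k + 1) * X ^ (-(c / 2)) <
      |(descPochhammer ℝ k).eval (c / 2)| / k.factorial * (N : ℝ) ^ (c / 2 - k))
    (B : Finset ℕ) (hB : ∀ n ∈ B, X ≤ n ∧ n ≤ N ∧ ∃ s m : ℕ, 0 < s ∧ (s : ℝ) ≤ Z ∧
      ⌊(n : ℝ) ^ c⌋ = (s : ℤ) * (m : ℤ) ^ 2) :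
    (#B : ℝ) ≤ k * (Z * (N / L + 1)) := by
  choose! hBX hBN s m hs0 hsZ hfl using hB
  have hL0 : 0 < L := by linarith
  let T : Finset (ℕ × ℕ) := Icc 1 ⌊Z⌋₊ ×ˢ range (⌊N / L⌋₊ + 1)
  have hmaps : ∀ n ∈ B, (s n, ⌊(n : ℝ) / L⌋₊) ∈ T := fun n hn => by
    simp only [T, mem_product, mem_Icc, mem_range, Nat.lt_succ_iff]
    refine ⟨⟨hs0 n hn, Nat.le_floor (hsZ n hn)⟩, Nat.floor_le_floor ?_⟩
    have : (n : ℝ) ≤ N := by exact_mod_cast hBN n hn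
    gcongr
  have hfib : ∀ p ∈ T, #{n ∈ B | (s n, ⌊(n : ℝ) / L⌋₊) = p} ≤ k := by
    rintro ⟨σ, q⟩ hp
    by_contra! hcard
    obtain ⟨t, htB, ht⟩ := exists_subset_card_eq (Nat.succ_le_of_lt hcard)
    have hmem : ∀ n ∈ t, n ∈ B ∧ s n = σ ∧ ⌊(n : ℝ) / L⌋₊ = q := fun n hn => by
      simpa using htB hn
    have hσ : 1 ≤ √(σ : ℝ) := by
      simp only [T, mem_product, mem_Icc] at hp
      exact Real.one_le_sqrt.2 (by exact_mod_cast hp.1.1)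
    have hblock : ∀ n ∈ t, (q : ℝ) * L ≤ n ∧ (n : ℝ) < (q + 1) * L := fun n hn => by
      have h := (hmem n hn).2.2
      rw [Nat.floor_eq_iff (by positivity), le_div_iff₀ hL0, div_lt_iff₀ hL0] at h
      exact h
    rcases one_le_or_le_of_rpow_near_multiples (Y := N) hX hL hσ hck t ht
      (fun n hn => ⟨hBX n (hmem n hn).1, by exact_mod_cast hBN n (hmem n hn).1⟩)
      (fun i hi j hj => by
        have hi' := hblock i hi
        have hj' := hblock j hj
        rw [abs_le]
        constructor <;> nlinarith)
      (fun n => (m n : ℤ))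
      (fun n hn => abs_rpow_sub_sqrt_mul_le hc hX (hBX n (hmem n hn).1) (by
        rw [← (hmem n hn).2.1]
        exact hfl n (hmem n hn).1)) with h | h
    · linarith
    · linarith
  have hcard : #B ≤ k * #T := by
    exact card_le_mul_card_image_of_maps_to hmaps k hfib
  have hT : (#T : ℝ) ≤ Z * (N / L + 1) := by
    simp only [T, card_product, Nat.card_Icc, card_range, Nat.add_sub_cancel]
    push_cast
    gcongr
    · exact Nat.floor_le hZ
    · exact Nat.floor_le (by positivity)
  calc (#B : ℝ) ≤ k * #T := by exact_mod_cast hcard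
    _ ≤ _ := by gcongr

lemma tendsto_const_mul_natCast_rpow_neg (a : ℝ) {e : ℝ} (he : e < 0) :
    Tendsto (fun N : ℕ => a * (N : ℝ) ^ e) atTop (𝓝 0) := by
  have h := (tendsto_rpow_neg_atTop (neg_pos.2 he)).comp (tendsto_natCast_atTop_atTop (R := ℝ))
  simpa [Function.comp_def] using h.const_mul a

theorem large_squarefree_parts (c : ℝ) (hc : 1 < c) (hc' : ∀ n : ℕ, c ≠ n) :
    ∃ θ : ℝ, 0 < θ ∧ ∀ δ : ℝ, 0 < δ → ∃ N₀ : ℕ, ∀ N : ℕ, N₀ ≤ N →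
      ({n : ℕ | 1 ≤ n ∧ n ≤ N ∧ ∃ s m : ℕ, 0 < s ∧ Squarefree s ∧ (s : ℝ) ≤ (N : ℝ) ^ θ ∧
          0 < m ∧ ⌊(n : ℝ) ^ c⌋ = (s : ℤ) * (m : ℤ) ^ 2}.ncard : ℝ) ≤ δ * N := by
  set α := c / 2 with hα
  have hα0 : 0 < α := by positivity
  have hαnat : ∀ j : ℕ, α ≠ j := fun j h => hc' (2 * j) (by push_cast; linarith)
  set k := ⌊α⌋₊ + 1 with hk
  have hαk : α < k := by exact_mod_cast Nat.lt_floor_add_one α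
  have hfl : (⌊α⌋₊ : ℝ) < α := lt_of_le_of_ne (Nat.floor_le hα0.le) (hαnat _).symm
  have hkα : (k : ℝ) < α + 1 := by rw [hk]; push_cast; linarith
  have hk1 : (1 : ℝ) ≤ k := by rw [hk]; push_cast; linarith [Nat.cast_nonneg (α := ℝ) ⌊α⌋₊]
  have hk2 : (k : ℝ) < 2 * α := by
    rcases Nat.eq_zero_or_pos ⌊α⌋₊ with h | h
    · rw [hk, h]; push_cast; linarith
    · have : (1 : ℝ) ≤ (⌊α⌋₊ : ℝ) := by exact_mod_cast h
      linarith
  set b := |(descPochhammer ℝ k).eval α| / k.factorial with hb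
  have hb0 : 0 < b := by
    refine div_pos (abs_pos.2 ?_) (by positivity)
    rw [descPochhammer_eval_eq_prod_range]
    exact prod_ne_zero_iff.2 fun j _ => sub_ne_zero.2 (hαnat j)
  set ρ : ℝ := (k - α) / (2 * (k * (k + 1))) with hρ
  have hρ0 : 0 < ρ := div_pos (by linarith) (by positivity)
  have hρk : ρ * (k * (k + 1)) = (k - α) / 2 := by rw [hρ]; field_simp
  have hρ1 : ρ < 1 := by
    rw [hρ, div_lt_one (by positivity)]
    nlinarith
  refine ⟨ρ / 2, by positivity, fun δ hδ => ?_⟩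
  have hδ2 : 0 < δ / 2 := by positivity
  have lim1 := (tendsto_const_mul_natCast_rpow_neg (b * (δ / 2) ^ (α - k))
    (by linarith : (α - k) / 2 < 0)).add
    (tendsto_const_mul_natCast_rpow_neg ((k + 1) * (δ / 2) ^ (-α))
      (by linarith : (k - α) / 2 - α < 0))
  have lim2 := tendsto_const_mul_natCast_rpow_neg ((k + 1) * (δ / 2) ^ (-α))
    (by linarith : k - 2 * α < 0)
  have lim3 := (tendsto_const_mul_natCast_rpow_neg k (by linarith : -(ρ / 2) < 0)).add
    (tendsto_const_mul_natCast_rpow_neg k (by linarith : ρ / 2 - 1 < 0))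
  rw [add_zero] at lim1 lim3
  obtain ⟨N₀, hN₀⟩ := eventually_atTop.1 ((lim1.eventually_lt_const one_pos).and
    ((lim2.eventually_lt_const hb0).and ((lim3.eventually_lt_const hδ2).and
      (eventually_ge_atTop 1))))
  refine ⟨N₀, fun N hN => ?_⟩
  obtain ⟨h1, h2, h3, hN1⟩ := hN₀ N hN
  have hNR : (1 : ℝ) ≤ N := by exact_mod_cast hN1
  have hN0 : (0 : ℝ) < N := by linarith
  have hlarge : ((N : ℝ) ^ ρ) ^ (k * (k + 1)) *
      (b * (δ / 2 * N) ^ (α - k) + (k + 1) * (δ / 2 * N) ^ (-α)) < 1 := by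
    refine lt_of_eq_of_lt ?_ h1
    rw [← Real.rpow_natCast, ← Real.rpow_mul hN0.le, Real.mul_rpow hδ2.le hN0.le,
      Real.mul_rpow hδ2.le hN0.le]
    push_cast
    rw [hρk, show (α - k) / 2 = (k - α) / 2 + (α - k) by ring,
      show (k - α) / 2 - α = (k - α) / 2 + -α by ring, Real.rpow_add hN0, Real.rpow_add hN0]
    ring
  have hsmall : (k + 1) * (δ / 2 * N) ^ (-α) < b * (N : ℝ) ^ (α - k) := by
    have := mul_lt_mul_of_pos_right h2 (Real.rpow_pos_of_pos hN0 (α - k))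
    rwa [mul_assoc, ← Real.rpow_add hN0, show k - 2 * α + (α - k) = -α by ring, mul_assoc,
      ← Real.mul_rpow hδ2.le hN0.le] at this
  have hcount : k * ((N : ℝ) ^ (ρ / 2) * (N / (N : ℝ) ^ ρ + 1)) ≤ δ / 2 * N := by
    have := (mul_lt_mul_of_pos_right h3 hN0).le
    refine le_of_eq_of_le ?_ this
    rw [show ρ / 2 - 1 = ρ / 2 + -1 by ring, show -(ρ / 2) = ρ / 2 + -ρ by ring,
      Real.rpow_add hN0, Real.rpow_add hN0, Real.rpow_neg hN0.le, Real.rpow_neg_one]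
    field_simp
  classical
  set E := {n : ℕ | 1 ≤ n ∧ n ≤ N ∧ ∃ s m : ℕ, 0 < s ∧ Squarefree s ∧
    (s : ℝ) ≤ (N : ℝ) ^ (ρ / 2) ∧ 0 < m ∧ ⌊(n : ℝ) ^ c⌋ = (s : ℤ) * (m : ℤ) ^ 2} with hE
  set B : Finset ℕ := {n ∈ Icc 1 N | n ∈ E ∧ δ / 2 * N ≤ n} with hBdef
  have hsub : E ⊆ ↑(Icc 1 ⌊δ / 2 * N⌋₊ ∪ B) := fun n hn => by
    have hn' := hn
    obtain ⟨hn1, hnN, -⟩ := hn'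
    simp only [coe_union, Set.mem_union, mem_coe, mem_Icc, hBdef, mem_filter]
    rcases le_total (n : ℝ) (δ / 2 * N) with h | h
    · exact Or.inl ⟨hn1, Nat.le_floor h⟩
    · exact Or.inr ⟨⟨hn1, hnN⟩, hn, h⟩
  have hBcard := (card_le_of_fibers_near_multiples (N := N) (k := k)
    (Real.one_le_rpow hNR hρ0.le) (Real.rpow_nonneg hN0.le (ρ / 2)) (by linarith : 0 ≤ c)
    (by positivity : 0 < δ / 2 * N) hαk.le hlarge hsmall B (fun n hn => by
      obtain ⟨-, ⟨-, hnN, s, m, hs, -, hsZ, -, h⟩, hnX⟩ := mem_filter.1 hn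
      exact ⟨hnX, hnN, s, m, hs, hsZ, h⟩)).trans hcount
  have hEcard : E.ncard ≤ ⌊δ / 2 * N⌋₊ + #B := by
    refine (Set.ncard_le_ncard hsub (finite_toSet _)).trans ?_
    rw [Set.ncard_coe_finset]
    exact (card_union_le _ _).trans (by simp)
  calc (E.ncard : ℝ) ≤ ⌊δ / 2 * N⌋₊ + #B := by exact_mod_cast hEcard
    _ ≤ δ / 2 * N + δ / 2 * N := add_le_add (Nat.floor_le (by positivity)) hBcard
    _ = δ * N := by ring
end
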